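/- Let (r, u, v, t) be a composition of n. Let C be a row-standard (r,u,v,t)-tableau of type λ ⊨ n, let B be the row-standard (r+u, v+t)-tableau with r ones and u twos in its first row and v threes and t fours in its second row, and let A be the row-standard (r+u, v+t)-tableau with A^1 = C^1 ⊔ C^2 and A^2 = C^3 ⊔ C^4. Then the composite φ_B φ_C : M^{(r+u,v+t)} → M^λ (apply φ_B first) equals (∏_i [A^1_i choose C^1_i]_q [A^2_i choose C^3_i]_q) (∏_{i<j} q^{C^1_j C^2_i + C^3_j C^4_i}) · φ_A. -/

import Mathlib

open scoped Classical

noncomputable section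

namespace FayersSemistd

/-- The value at `q` of the Gaussian (quantum) binomial coefficient polynomial
`[a choose b]`, defined via the `q`-Pascal recurrence. -/
def qBinom {F : Type*} [Field F] (q : F) : ℕ → ℕ → F
  | _, 0 => 1
  | 0, _+1 => 0
  | a+1, b+1 => qBinom q a b + q ^ (b+1) * qBinom q a (b+1)

/-- `∏_i [A_i + B_i choose A_i]_q`, where `A_i`, `B_i` are multiplicities in the
multisets `A` and `B`. -/
def qBinomProd {F : Type*} [Field F] (q : F) (A B : Multiset ℕ) : F :=
  ∏ i ∈ (A + B).toFinset, qBinom q ((A + B).count i) (A.count i)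

/-- `∑_{i<j} A_j * B_i` : the number of pairs `(x,y)` with `x ∈ A`, `y ∈ B`, `y < x`,
counted with multiplicity. -/
def invPairs (A B : Multiset ℕ) : ℕ :=
  ((A.product B).filter (fun p => p.2 < p.1)).card

/-- The Coxeter length of a permutation of `{0,…,n-1}`: its number of inversions. -/
def permLength {n : ℕ} (w : Equiv.Perm (Fin n)) : ℕ :=
  (Finset.univ.filter (fun p : Fin n × Fin n => p.1 < p.2 ∧ w p.2 < w p.1)).card

/-- `λ_0 + ⋯ + λ_{r-1}`. -/
def cumSum (lam : ℕ → ℕ) (r : ℕ) : ℕ := ∑ i ∈ Finset.range r, lam i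

/-- The (0-indexed) row of the diagram of `λ` containing the (0-indexed) position `p`,
when positions are listed row by row. -/
def rowOf (lam : ℕ → ℕ) (p : ℕ) : ℕ := sInf {r | p < cumSum lam (r+1)}

/-- `λ` is a composition of `n`: finitely many nonzero parts, summing to `n`. -/
def IsComposition (n : ℕ) (lam : ℕ → ℕ) : Prop :=
  ∃ N, (∀ r, N ≤ r → lam r = 0) ∧ cumSum lam N = n

/-- `μ` is a partition of `n`. -/
def IsPartition (n : ℕ) (mu : ℕ → ℕ) : Prop := IsComposition n mu ∧ Antitone mu

/-- The conjugate partition (0-indexed): `conjP μ i = #{r | μ r > i}`. -/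
def conjP (mu : ℕ → ℕ) (i : ℕ) : ℕ := sInf {r | mu r ≤ i}

/-- The standard Young subgroup `W_λ` of `S_n` (as a set): the permutations preserving
each consecutive block of sizes `λ_0, λ_1, …`. -/
def youngW {n : ℕ} (lam : ℕ → ℕ) : Set (Equiv.Perm (Fin n)) :=
  {w | ∀ p : Fin n, rowOf lam ((w p : Fin n) : ℕ) = rowOf lam (p : ℕ)}

/-- The adjacent transposition `(i, i+1)` (0-indexed) in `S_n`. -/
def adjT {n : ℕ} (i : ℕ) (h : i + 1 < n) : Equiv.Perm (Fin n) :=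
  Equiv.swap ⟨i, Nat.lt_of_succ_lt h⟩ ⟨i+1, h⟩

/-- `T : S_n → H` is the standard basis of an Iwahori–Hecke algebra of `S_n` over `F`
with parameter `q`.  Permutations act on the right, so the product `w·s` of the paper
is `s * w` in Mathlib's convention; the multiplication rule
`T_w T_s = T_{ws}` (length increasing) resp. `T_w T_s = q T_{ws} + (q-1) T_w`
(length decreasing) determines the algebra structure on the basis. -/
structure IsHeckeBasis {F : Type*} [Field F] {H : Type*} [Ring H] [Algebra F H] {n : ℕ}
    (q : F) (T : Equiv.Perm (Fin n) → H) : Prop where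
  li : LinearIndependent F T
  total : Submodule.span F (Set.range T) = ⊤
  one : T 1 = 1
  mul_adj_asc : ∀ (w : Equiv.Perm (Fin n)) (i : ℕ) (h : i + 1 < n),
    permLength w < permLength (adjT i h * w) →
    T w * T (adjT i h) = T (adjT i h * w)
  mul_adj_desc : ∀ (w : Equiv.Perm (Fin n)) (i : ℕ) (h : i + 1 < n),
    permLength (adjT i h * w) < permLength w →
    T w * T (adjT i h) = q • T (adjT i h * w) + (q - 1) • T w

variable {F : Type*} [Field F] {H : Type*} [Ring H] [Algebra F H] {n : ℕ}

/-- `x_λ = ∑_{w ∈ W_λ} T_w`. -/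
def xElt (T : Equiv.Perm (Fin n) → H) (lam : ℕ → ℕ) : H :=
  ∑ w ∈ Finset.univ.filter (· ∈ youngW lam), T w

/-- `y_λ = ∑_{w ∈ W_λ} (-q)^{-l(w)} T_w`. -/
def yElt (q : F) (T : Equiv.Perm (Fin n) → H) (lam : ℕ → ℕ) : H :=
  ∑ w ∈ Finset.univ.filter (· ∈ youngW lam), ((-q)⁻¹) ^ permLength w • T w

/-- The double coset `W_λ d W_μ` (paper convention: maps act on the right, so the
paper product `u·d·v` is `v * d * u` in Mathlib's convention). -/
def doubleCoset {n : ℕ} (lam mu : ℕ → ℕ) (d : Equiv.Perm (Fin n)) :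
    Set (Equiv.Perm (Fin n)) :=
  {w | ∃ u ∈ youngW (n := n) lam, ∃ v ∈ youngW (n := n) mu, w = v * d * u}

/-- `∑_{w ∈ W_λ 1_A W_μ} T_w`, the image `x_μ φ_A` of `x_μ` under the tableau
homomorphism `φ_A : M^μ → M^λ`, where `d = 1_A`. -/
def XPhi (T : Equiv.Perm (Fin n) → H) (lam mu : ℕ → ℕ) (d : Equiv.Perm (Fin n)) : H :=
  ∑ w ∈ Finset.univ.filter (· ∈ doubleCoset lam mu d), T w

/-- A row-standard tableau is recorded by the multisets of entries of its rows; it has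
shape `μ` when row `r` has `μ_r` entries. -/
def RowsOfShape (mu : ℕ → ℕ) (A : ℕ → Multiset ℕ) : Prop := ∀ r, (A r).card = mu r

/-- The tableau with rows `A 0, A 1, …` has type `λ` when the entry `v` occurs `λ_v`
times in total (entries and types are 0-indexed). -/
def HasType (A : ℕ → Multiset ℕ) (lam : ℕ → ℕ) : Prop :=
  ∀ v, (∑ᶠ r, (A r).count v) = lam v

/-- The entry in row `r`, column `c` (0-indexed) of the row-standard tableau with row
multisets `A`. -/
def entryAt (A : ℕ → Multiset ℕ) (r c : ℕ) : ℕ := ((A r).sort (· ≤ ·)).getD c 0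

/-- `d = 1_A` for the row-standard `μ`-tableau `A` of type `λ`: the tableau `t^λ d`
(whose entry at position `p` is `d p`) is row-standard (first clause), and the entry
`d p` lies in row `r` of `t^λ d` exactly when the position occupied by `d p` in `t^μ`
is occupied by `r` in `A` (second clause). -/
def Is1A {n : ℕ} (mu lam : ℕ → ℕ) (A : ℕ → Multiset ℕ) (d : Equiv.Perm (Fin n)) : Prop :=
  (∀ p p' : Fin n, rowOf lam (p : ℕ) = rowOf lam (p' : ℕ) → p < p' → d p < d p') ∧
  (∀ p : Fin n,
    entryAt A (rowOf mu ((d p : Fin n) : ℕ))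
      (((d p : Fin n) : ℕ) - cumSum mu (rowOf mu ((d p : Fin n) : ℕ)))
      = rowOf lam (p : ℕ))

/-- A row-standard tableau is semistandard if its columns are strictly increasing. -/
def Semistandard (mu : ℕ → ℕ) (A : ℕ → Multiset ℕ) : Prop :=
  ∀ r c, c < mu (r+1) → entryAt A r c < entryAt A (r+1) c

/-- The (0-indexed) column of the position `p` in the diagram of `μ`. -/
def colIdx (mu : ℕ → ℕ) (p : ℕ) : ℕ := p - cumSum mu (rowOf mu p)

/-- `w = w_μ`, i.e. `t^μ w = t_μ`: the image of position `p` is the number of positions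
coming strictly before `p` in the column-reading order of the diagram of `μ`. -/
def IsWmu {n : ℕ} (mu : ℕ → ℕ) (w : Equiv.Perm (Fin n)) : Prop :=
  ∀ p : Fin n, ((w p : Fin n) : ℕ) = (Finset.univ.filter (fun p' : Fin n =>
    colIdx mu (p' : ℕ) < colIdx mu (p : ℕ) ∨
      (colIdx mu (p' : ℕ) = colIdx mu (p : ℕ) ∧ rowOf mu (p' : ℕ) < rowOf mu (p : ℕ)))).card

def comp1 (a : ℕ) : ℕ → ℕ := fun r => if r = 0 then a else 0
def comp2 (a b : ℕ) : ℕ → ℕ := fun r => if r = 0 then a else if r = 1 then b else 0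
def comp3 (a b c : ℕ) : ℕ → ℕ :=
  fun r => if r = 0 then a else if r = 1 then b else if r = 2 then c else 0
def comp4 (a b c d : ℕ) : ℕ → ℕ :=
  fun r => if r = 0 then a else if r = 1 then b else if r = 2 then c else if r = 3 then d else 0
def rows1 (a : Multiset ℕ) : ℕ → Multiset ℕ := fun r => if r = 0 then a else 0
def rows2 (a b : Multiset ℕ) : ℕ → Multiset ℕ :=
  fun r => if r = 0 then a else if r = 1 then b else 0
def rows3 (a b c : Multiset ℕ) : ℕ → Multiset ℕ :=
  fun r => if r = 0 then a else if r = 1 then b else if r = 2 then c else 0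
def rows4 (a b c d : Multiset ℕ) : ℕ → Multiset ℕ :=
  fun r => if r = 0 then a else if r = 1 then b else if r = 2 then c else if r = 3 then d else 0

end FayersSemistd

namespace FayersSemistd

section
open Finset

/-! ### Inversions and adjacent transpositions -/

lemma adjT_lt_adjT {n i : ℕ} {h : i + 1 < n} {x y : Fin n} (hxy : x < y)
    (hne : ¬ ((x : ℕ) = i ∧ (y : ℕ) = i + 1)) : adjT i h x < adjT i h y := by
  unfold adjT
  simp only [Equiv.swap_apply_def, Fin.ext_iff, Fin.lt_def] at *
  split_ifs <;> simp_all <;> omega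

lemma adjT_mul_self {n i : ℕ} (h : i + 1 < n) : adjT i h * adjT i h = 1 :=
  Equiv.swap_mul_self _ _

lemma adjT_mul_adjT_mul {n i : ℕ} (h : i + 1 < n) (w : Equiv.Perm (Fin n)) :
    adjT i h * (adjT i h * w) = w := by
  rw [← mul_assoc, adjT_mul_self, one_mul]

lemma adjT_inv {n i : ℕ} (h : i + 1 < n) : (adjT i h)⁻¹ = adjT i h := Equiv.swap_inv _ _

lemma adjT_left {n i : ℕ} (h : i + 1 < n) : adjT i h ⟨i, by omega⟩ = ⟨i + 1, h⟩ :=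
  Equiv.swap_apply_left _ _

lemma adjT_right {n i : ℕ} (h : i + 1 < n) : adjT i h ⟨i + 1, h⟩ = ⟨i, by omega⟩ :=
  Equiv.swap_apply_right _ _

/-- Left multiplication by `adjT i` creates exactly one inversion when `i` occurs before `i + 1`. -/
lemma inversion_adjT_mul_iff {n i : ℕ} (h : i + 1 < n) {w : Equiv.Perm (Fin n)}
    (hw : w⁻¹ ⟨i, by omega⟩ < w⁻¹ ⟨i + 1, h⟩) (a b : Fin n) :
    (a < b ∧ (adjT i h * w) b < (adjT i h * w) a) ↔
      (a < b ∧ w b < w a) ∨ (a = w⁻¹ ⟨i, by omega⟩ ∧ b = w⁻¹ ⟨i + 1, h⟩) := by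
  simp only [Equiv.Perm.mul_apply, Equiv.Perm.eq_inv_iff_eq]
  constructor
  · rintro ⟨hab, hlt⟩
    by_cases hc : (w a : ℕ) = i ∧ (w b : ℕ) = i + 1
    · exact Or.inr ⟨Fin.ext hc.1, Fin.ext hc.2⟩
    · left
      refine ⟨hab, lt_of_not_ge fun hge => ?_⟩
      rcases hge.lt_or_eq with h1 | h1
      · exact absurd (adjT_lt_adjT (h := h) h1 hc) hlt.asymm
      · exact hab.ne (w.injective h1)
  · rintro (⟨hab, hlt⟩ | ⟨ha, hb⟩)
    · refine ⟨hab, adjT_lt_adjT hlt ?_⟩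
      rintro ⟨h1, h2⟩
      have e1 : b = w⁻¹ ⟨i, by omega⟩ := by
        rw [Equiv.Perm.eq_inv_iff_eq]; exact Fin.ext h1
      have e2 : a = w⁻¹ ⟨i + 1, h⟩ := by
        rw [Equiv.Perm.eq_inv_iff_eq]; exact Fin.ext h2
      rw [← e1, ← e2] at hw
      exact hw.asymm hab
    · refine ⟨?_, ?_⟩
      · rw [← Equiv.Perm.eq_inv_iff_eq] at ha hb
        rwa [ha, hb]
      · rw [ha, hb, adjT_left, adjT_right, Fin.lt_def]
        exact Nat.lt_succ_self i

lemma permLength_adjT_mul {n i : ℕ} (h : i + 1 < n) {w : Equiv.Perm (Fin n)}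
    (hw : w⁻¹ ⟨i, by omega⟩ < w⁻¹ ⟨i + 1, h⟩) :
    permLength (adjT i h * w) = permLength w + 1 := by
  have : (univ.filter (fun p : Fin n × Fin n =>
      p.1 < p.2 ∧ (adjT i h * w) p.2 < (adjT i h * w) p.1)) =
      insert (w⁻¹ ⟨i, by omega⟩, w⁻¹ ⟨i + 1, h⟩)
        (univ.filter (fun p : Fin n × Fin n => p.1 < p.2 ∧ w p.2 < w p.1)) := by
    ext ⟨a, b⟩
    simp only [mem_filter, mem_univ, true_and, mem_insert, Prod.mk.injEq]
    rw [inversion_adjT_mul_iff h hw, or_comm]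
  unfold permLength
  rw [this, card_insert_of_notMem]
  simp

lemma permLength_one {n : ℕ} : permLength (1 : Equiv.Perm (Fin n)) = 0 := by
  rw [permLength, card_eq_zero, filter_eq_empty_iff]
  exact fun p _ hp => hp.1.asymm hp.2

lemma adjT_mul_ascent {n i : ℕ} (h : i + 1 < n) {w : Equiv.Perm (Fin n)}
    (hw : w⁻¹ ⟨i + 1, h⟩ < w⁻¹ ⟨i, by omega⟩) :
    (adjT i h * w)⁻¹ ⟨i, by omega⟩ < (adjT i h * w)⁻¹ ⟨i + 1, h⟩ := by
  simpa only [mul_inv_rev, adjT_inv, Equiv.Perm.mul_apply, adjT_left, adjT_right] using hw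

lemma ascent_or_descent {n i : ℕ} (h : i + 1 < n) (w : Equiv.Perm (Fin n)) :
    w⁻¹ ⟨i, by omega⟩ < w⁻¹ ⟨i + 1, h⟩ ∨ w⁻¹ ⟨i + 1, h⟩ < w⁻¹ ⟨i, by omega⟩ := by
  apply lt_or_gt_of_ne
  simp

lemma eq_one_of_strictMono {n : ℕ} {w : Equiv.Perm (Fin n)} (hw : StrictMono w) : w = 1 := by
  have := (hw.range_inj strictMono_id).1 (by simp [w.surjective.range_eq])
  ext x
  simp [this]

lemma exists_descent {n : ℕ} {w : Equiv.Perm (Fin n)} (hw : w ≠ 1) :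
    ∃ (i : ℕ) (h : i + 1 < n), w⁻¹ ⟨i + 1, h⟩ < w⁻¹ ⟨i, by omega⟩ := by
  by_contra! hcon
  apply hw
  rcases n with _ | n
  · exact Subsingleton.elim _ _
  · rw [← inv_eq_one]
    apply eq_one_of_strictMono
    rw [Fin.strictMono_iff_lt_succ]
    intro i
    have h : (i : ℕ) + 1 < n + 1 := by omega
    exact (ascent_or_descent h w).resolve_right (hcon i h).not_gt

/-- Induction on permutations by multiplying by adjacent transpositions that lengthen. -/
lemma perm_ascent_induction {n : ℕ} {P : Equiv.Perm (Fin n) → Prop} (one : P 1)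
    (step : ∀ (w : Equiv.Perm (Fin n)) (i : ℕ) (h : i + 1 < n),
      w⁻¹ ⟨i, by omega⟩ < w⁻¹ ⟨i + 1, h⟩ → P w → P (adjT i h * w)) (w : Equiv.Perm (Fin n)) :
    P w := by
  induction hl : permLength w using Nat.strong_induction_on generalizing w with
  | _ l ih =>
    by_cases hw : w = 1
    · rwa [hw]
    obtain ⟨i, h, hd⟩ := exists_descent hw
    have ha := adjT_mul_ascent h hd
    have hlen := permLength_adjT_mul h ha
    rw [adjT_mul_adjT_mul] at hlen
    rw [← adjT_mul_adjT_mul h w]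
    exact step _ i h ha (ih _ (by omega) _ rfl)

/-! ### Multiplication in the Hecke algebra -/

variable {F : Type*} [Field F] {H : Type*} [Ring H] [Algebra F H] {n : ℕ} {q : F}
  {T : Equiv.Perm (Fin n) → H}

lemma IsHeckeBasis.mul_ascent (hT : IsHeckeBasis q T) {w : Equiv.Perm (Fin n)} {i : ℕ}
    (h : i + 1 < n) (hw : w⁻¹ ⟨i, by omega⟩ < w⁻¹ ⟨i + 1, h⟩) :
    T w * T (adjT i h) = T (adjT i h * w) :=
  hT.mul_adj_asc w i h (by rw [permLength_adjT_mul h hw]; omega)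

lemma IsHeckeBasis.mul_descent (hT : IsHeckeBasis q T) {w : Equiv.Perm (Fin n)} {i : ℕ}
    (h : i + 1 < n) (hw : w⁻¹ ⟨i + 1, h⟩ < w⁻¹ ⟨i, by omega⟩) :
    T w * T (adjT i h) = q • T (adjT i h * w) + (q - 1) • T w := by
  refine hT.mul_adj_desc w i h ?_
  have := permLength_adjT_mul h (adjT_mul_ascent h hw)
  rw [adjT_mul_adjT_mul] at this
  omega

/-- `T_u T_d = T_{ud}` when no inversion of `d` is undone by `u`. -/
lemma IsHeckeBasis.mul_eq (hT : IsHeckeBasis q T) (d u : Equiv.Perm (Fin n))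
    (hdu : ∀ a b, a < b → d b < d a → u⁻¹ a < u⁻¹ b) : T u * T d = T (d * u) := by
  induction d using perm_ascent_induction with
  | one => simp [hT.one]
  | step d i h hd ih =>
    rw [← hT.mul_ascent h hd, ← mul_assoc, ih, hT.mul_ascent h, mul_assoc]
    · simp only [mul_inv_rev, Equiv.Perm.mul_apply]
      have := (inversion_adjT_mul_iff h hd _ _).2 (Or.inr ⟨rfl, rfl⟩)
      exact hdu _ _ this.1 this.2
    · intro a b hab hba
      have := (inversion_adjT_mul_iff h hd a b).2 (Or.inl ⟨hab, hba⟩)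
      exact hdu _ _ this.1 this.2

/-- The basis `T` of the Hecke algebra. -/
def IsHeckeBasis.basis (hT : IsHeckeBasis q T) : Module.Basis (Equiv.Perm (Fin n)) F H :=
  Module.Basis.mk hT.li hT.total.ge

lemma IsHeckeBasis.basis_apply (hT : IsHeckeBasis q T) (w : Equiv.Perm (Fin n)) :
    hT.basis w = T w := by
  simp [IsHeckeBasis.basis]

lemma IsHeckeBasis.repr_T (hT : IsHeckeBasis q T) (v w : Equiv.Perm (Fin n)) :
    hT.basis.repr (T v) w = if v = w then 1 else 0 := by
  rw [← hT.basis_apply, Module.Basis.repr_self, Finsupp.single_apply]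

lemma IsHeckeBasis.repr_sum (hT : IsHeckeBasis q T) (S : Finset (Equiv.Perm (Fin n)))
    (w : Equiv.Perm (Fin n)) :
    hT.basis.repr (∑ v ∈ S, T v) w = if w ∈ S then 1 else 0 := by
  rw [map_sum, Finsupp.finsetSum_apply]
  simp [hT.repr_T]

lemma IsHeckeBasis.repr_mul_adjT (hT : IsHeckeBasis q T) {w : Equiv.Perm (Fin n)} {i : ℕ}
    (h : i + 1 < n) (hw : w⁻¹ ⟨i, by omega⟩ < w⁻¹ ⟨i + 1, h⟩) (a : H) :
    hT.basis.repr (a * T (adjT i h)) w = q * hT.basis.repr a (adjT i h * w) := by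
  suffices hT.basis.coord w ∘ₗ LinearMap.mulRight F (T (adjT i h)) =
      q • hT.basis.coord (adjT i h * w) from LinearMap.congr_fun this a
  refine hT.basis.ext fun v => ?_
  simp only [LinearMap.comp_apply, LinearMap.mulRight_apply, LinearMap.smul_apply,
    Module.Basis.coord_apply, hT.basis_apply, smul_eq_mul]
  have key : adjT i h * v = w ↔ v = adjT i h * w := by
    constructor
    · rintro rfl; rw [adjT_mul_adjT_mul]
    · rintro rfl; rw [adjT_mul_adjT_mul]
  rcases ascent_or_descent h v with hv | hv
  · have hne : v ≠ adjT i h * w := by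
      rintro rfl
      simp only [mul_inv_rev, adjT_inv, Equiv.Perm.mul_apply, adjT_left, adjT_right] at hv
      exact hv.asymm hw
    rw [hT.mul_ascent h hv, hT.repr_T, hT.repr_T, if_neg (key.not.2 hne), if_neg hne, mul_zero]
  · have hne : v ≠ w := by
      rintro rfl
      exact hv.asymm hw
    rw [hT.mul_descent h hv]
    simp [hT.repr_T, key, hne]

lemma IsHeckeBasis.repr_mul_adjT' (hT : IsHeckeBasis q T) {w : Equiv.Perm (Fin n)} {i : ℕ}
    (h : i + 1 < n) (hw : w⁻¹ ⟨i + 1, h⟩ < w⁻¹ ⟨i, by omega⟩) (a : H) :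
    hT.basis.repr (a * T (adjT i h)) w =
      hT.basis.repr a (adjT i h * w) + (q - 1) * hT.basis.repr a w := by
  suffices hT.basis.coord w ∘ₗ LinearMap.mulRight F (T (adjT i h)) =
      hT.basis.coord (adjT i h * w) + (q - 1) • hT.basis.coord w from LinearMap.congr_fun this a
  refine hT.basis.ext fun v => ?_
  simp only [LinearMap.comp_apply, LinearMap.mulRight_apply, LinearMap.smul_apply,
    LinearMap.add_apply, Module.Basis.coord_apply, hT.basis_apply, smul_eq_mul]
  have key : adjT i h * v = w ↔ v = adjT i h * w := by
    constructor
    · rintro rfl; rw [adjT_mul_adjT_mul]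
    · rintro rfl; rw [adjT_mul_adjT_mul]
  rcases ascent_or_descent h v with hv | hv
  · have hne : v ≠ w := by
      rintro rfl
      exact hv.asymm hw
    rw [hT.mul_ascent h hv]
    simp [hT.repr_T, key, hne]
  · have hne : v ≠ adjT i h * w := by
      rintro rfl
      simp only [mul_inv_rev, adjT_inv, Equiv.Perm.mul_apply, adjT_left, adjT_right] at hv
      exact hv.asymm hw
    rw [hT.mul_descent h hv]
    simp [hT.repr_T, key, hne]

/-- The coefficient of `T_w` in `a T_d`, when `l(w d⁻¹) = l(w) + l(d)`. -/
lemma IsHeckeBasis.repr_mul (hT : IsHeckeBasis q T) (d w : Equiv.Perm (Fin n)) (a : H)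
    (hdw : ∀ i j, i < j → d⁻¹ j < d⁻¹ i → w⁻¹ i < w⁻¹ j) :
    hT.basis.repr (a * T d) w = q ^ permLength d * hT.basis.repr a (d⁻¹ * w) := by
  induction d using perm_ascent_induction generalizing w with
  | one =>
    simp [hT.one, permLength_one]
  | step d i h hd ih =>
    have hw : w⁻¹ ⟨i, by omega⟩ < w⁻¹ ⟨i + 1, h⟩ := by
      apply hdw _ _ (Fin.lt_def.2 (Nat.lt_succ_self i))
      simpa only [mul_inv_rev, adjT_inv, Equiv.Perm.mul_apply, adjT_left, adjT_right] using hd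
    rw [← hT.mul_ascent h hd, ← mul_assoc, hT.repr_mul_adjT h hw, ih, permLength_adjT_mul h hd,
      mul_inv_rev, adjT_inv, mul_assoc (d⁻¹)]
    · ring
    · intro a b hab hba
      have hne : ¬ ((a : ℕ) = i ∧ (b : ℕ) = i + 1) := by
        rintro ⟨ha, hb⟩
        obtain rfl : b = ⟨i + 1, h⟩ := Fin.ext hb
        have ha' : a = ⟨i, by omega⟩ := Fin.ext ha
        rw [ha'] at hba
        exact hd.asymm hba
      have := hdw _ _ (adjT_lt_adjT (h := h) hab hne)
      simp only [mul_inv_rev, adjT_inv, Equiv.Perm.mul_apply] at this ⊢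
      apply this
      have e : ∀ x, adjT i h (adjT i h x) = x := fun x => by
        rw [← Equiv.Perm.mul_apply, adjT_mul_self, Equiv.Perm.one_apply]
      rwa [e, e]
end
end FayersSemistd

namespace FayersSemistd

section
open Finset

/-! ### Gaussian binomial products -/

variable {F : Type*} [Field F]

lemma qBinom_zero (q : F) (a : ℕ) : qBinom q a 0 = 1 := by cases a <;> rfl

lemma qBinom_eq_zero (q : F) {a b : ℕ} (h : a < b) : qBinom q a b = 0 := by
  induction a generalizing b with
  | zero => cases b with
    | zero => omega
    | succ b => rfl
  | succ a ih => cases b with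
    | zero => omega
    | succ b => rw [qBinom, ih (by omega), ih (by omega)]; simp

lemma qBinom_self (q : F) (a : ℕ) : qBinom q a a = 1 := by
  induction a with
  | zero => rfl
  | succ a ih => rw [qBinom, ih, qBinom_eq_zero q (Nat.lt_succ_self a)]; simp

lemma qBinomProd_eq_prod (q : F) (A B : Multiset ℕ) (S : Finset ℕ) (hS : ∀ x ∈ A + B, x ∈ S) :
    qBinomProd q A B = ∏ i ∈ S, qBinom q ((A + B).count i) (A.count i) := by
  apply prod_subset
  · intro x hx
    exact hS x (Multiset.mem_toFinset.1 hx)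
  · intro x _ hx
    rw [Multiset.mem_toFinset] at hx
    rw [Multiset.count_eq_zero.2 hx, Multiset.count_eq_zero.2 fun h => hx (by simp [h])]
    rfl

lemma qBinomProd_eq_mul (q : F) (A B : Multiset ℕ) (S : Finset ℕ) (hS : ∀ x ∈ A + B, x ∈ S)
    {x : ℕ} (hx : x ∈ S) :
    qBinomProd q A B = qBinom q ((A + B).count x) (A.count x) *
      ∏ i ∈ S.erase x, qBinom q ((A + B).count i) (A.count i) := by
  rw [qBinomProd_eq_prod q A B S hS, ← mul_prod_erase S _ hx]

lemma invPairs_eq_sum (A B : Multiset ℕ) :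
    invPairs A B = (A.map fun x => B.countP (· < x)).sum := by
  unfold invPairs
  induction A using Multiset.induction_on with
  | empty => simp [Multiset.product]
  | cons a A ih =>
    rw [Multiset.map_cons, Multiset.sum_cons, ← ih]
    have : (a ::ₘ A).product B = B.map (Prod.mk a) + A.product B :=
      Multiset.cons_product a A B
    rw [this, Multiset.filter_add, Multiset.card_add, Multiset.filter_map, Multiset.card_map,
      ← Multiset.countP_eq_card_filter]
    rfl

lemma invPairs_cons_left {x : ℕ} {A B : Multiset ℕ} (hB : ∀ y ∈ B, x ≤ y) :
    invPairs (x ::ₘ A) B = invPairs A B := by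
  rw [invPairs_eq_sum, invPairs_eq_sum, Multiset.map_cons, Multiset.sum_cons,
    Multiset.countP_eq_zero.2 fun y hy => (hB y hy).not_gt, zero_add]

lemma invPairs_cons_right {x : ℕ} {A B : Multiset ℕ} (hA : ∀ y ∈ A, x ≤ y) :
    invPairs A (x ::ₘ B) + A.count x = A.card + invPairs A B := by
  rw [invPairs_eq_sum, invPairs_eq_sum]
  induction A using Multiset.induction_on with
  | empty => simp
  | cons a A ih =>
    have := ih fun y hy => hA y (Multiset.mem_cons_of_mem hy)
    have ha := hA a (Multiset.mem_cons_self a A)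
    simp only [Multiset.map_cons, Multiset.sum_cons, Multiset.card_cons, Multiset.countP_cons,
      Multiset.count_cons] at this ⊢
    split_ifs <;> omega

/-- The merging coefficient for a pair of rows. -/
def mergeCoeff (q : F) (A B : Multiset ℕ) : F := qBinomProd q A B * q ^ invPairs A B

lemma mergeCoeff_zero (q : F) : mergeCoeff q 0 0 = 1 := by
  simp [mergeCoeff, qBinomProd, invPairs_eq_sum]

/-- Recursion for the merging coefficient obtained by removing a minimal entry. -/
lemma mergeCoeff_rec (q : F) {A B : Multiset ℕ} {x : ℕ} (hx : x ∈ A + B)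
    (hmin : ∀ y ∈ A + B, x ≤ y) :
    mergeCoeff q A B = (if x ∈ A then mergeCoeff q (A.erase x) B else 0) +
      (if x ∈ B then q ^ A.card * mergeCoeff q A (B.erase x) else 0) := by
  have hA : ∀ y ∈ A, x ≤ y := fun y hy => hmin y (by simp [hy])
  have hB : ∀ y ∈ B, x ≤ y := fun y hy => hmin y (by simp [hy])
  set S := (A + B).toFinset with hS
  have hxS : x ∈ S := by simpa [hS] using hx
  have h0 := qBinomProd_eq_mul q A B S (fun y hy => Multiset.mem_toFinset.2 hy) hxS
  have h1 := qBinomProd_eq_mul q (A.erase x) B S (fun y hy => Multiset.mem_toFinset.2 (by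
    rw [Multiset.mem_add] at *
    exact hy.imp_left Multiset.mem_of_mem_erase)) hxS
  have h2 := qBinomProd_eq_mul q A (B.erase x) S (fun y hy => Multiset.mem_toFinset.2 (by
    rw [Multiset.mem_add] at *
    exact hy.imp_right Multiset.mem_of_mem_erase)) hxS
  have e1 : ∏ i ∈ S.erase x, qBinom q ((A.erase x + B).count i) ((A.erase x).count i) =
      ∏ i ∈ S.erase x, qBinom q ((A + B).count i) (A.count i) :=
    prod_congr rfl fun i hi => by
      simp [Multiset.count_erase_of_ne (ne_of_mem_erase hi)]
  have e2 : ∏ i ∈ S.erase x, qBinom q ((A + B.erase x).count i) (A.count i) =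
      ∏ i ∈ S.erase x, qBinom q ((A + B).count i) (A.count i) :=
    prod_congr rfl fun i hi => by
      simp [Multiset.count_erase_of_ne (ne_of_mem_erase hi)]
  rw [e1] at h1
  rw [e2] at h2
  unfold mergeCoeff
  rw [h0, h1, h2]
  generalize ∏ i ∈ S.erase x, qBinom q ((A + B).count i) (A.count i) = Q
  have i1 : x ∈ A → invPairs (A.erase x) B = invPairs A B := fun h => by
    conv_rhs => rw [← Multiset.cons_erase h, invPairs_cons_left hB]
  have i2 : x ∈ B → invPairs A B + A.count x = A.card + invPairs A (B.erase x) := fun h => by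
    conv_lhs => rw [← Multiset.cons_erase h, invPairs_cons_right hA]
  by_cases hxA : x ∈ A <;> by_cases hxB : x ∈ B
  · rw [if_pos hxA, if_pos hxB, i1 hxA]
    have ha := Multiset.one_le_count_iff_mem.2 hxA
    have hb := Multiset.one_le_count_iff_mem.2 hxB
    have hi := i2 hxB
    simp only [Multiset.count_add, Multiset.count_erase_self]
    obtain ⟨a, ha'⟩ := Nat.exists_eq_add_of_le' ha
    obtain ⟨b, hb'⟩ := Nat.exists_eq_add_of_le' hb
    rw [ha'] at hi
    rw [ha', hb']
    have r1 : a + 1 + (b + 1) = (a + (b + 1)) + 1 := by omega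
    have r2 : a + 1 + (b + 1 - 1) = a + (b + 1) := by omega
    rw [r2, r1, qBinom, Nat.add_sub_cancel]
    have : q ^ A.card * q ^ invPairs A (B.erase x) = q ^ invPairs A B * q ^ (a + 1) := by
      rw [← pow_add, ← pow_add, hi]
    linear_combination (- qBinom q (a + (b + 1)) (a + 1) * Q) * this
  · rw [if_pos hxA, if_neg hxB, i1 hxA]
    simp [Multiset.count_eq_zero.2 hxB, qBinom_self]
  · rw [if_neg hxA, if_pos hxB]
    have := i2 hxB
    simp only [Multiset.count_eq_zero.2 hxA, qBinom_zero, add_zero] at this ⊢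
    rw [this, pow_add]
    ring
  · rw [Multiset.mem_add] at hx
    tauto

/-! ### Counting colourings of a sorted word -/

/-- The multiset of letters of the word `f` at positions of colour `b`. -/
def content {n : ℕ} (c f : Fin n → ℕ) (b : ℕ) : Multiset ℕ :=
  ∑ k, if c k = b then {f k} else 0

lemma content_succ {n : ℕ} (c f : Fin (n + 1) → ℕ) (b : ℕ) :
    content c f b = (if c 0 = b then {f 0} else 0) +
      content (fun k => c k.succ) (fun k => f k.succ) b := by
  simp [content, Fin.sum_univ_succ]

lemma card_content {n : ℕ} (c f : Fin n → ℕ) (b : ℕ) :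
    (content c f b).card = (univ.filter fun k => c k = b).card := by
  unfold content
  rw [Multiset.card_sum, card_filter]
  refine sum_congr rfl fun k _ => ?_
  split_ifs <;> simp

lemma count_content {n : ℕ} (c f : Fin n → ℕ) (b x : ℕ) :
    (content c f b).count x = (univ.filter fun k => c k = b ∧ f k = x).card := by
  unfold content
  rw [Multiset.count_sum', card_filter]
  refine sum_congr rfl fun k _ => ?_
  by_cases h1 : c k = b <;> by_cases h2 : f k = x <;>
    simp [h1, h2, eq_comm (a := x)]

lemma mem_content {n : ℕ} {c f : Fin n → ℕ} {b x : ℕ} :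
    x ∈ content c f b ↔ ∃ k, c k = b ∧ f k = x := by
  rw [← Multiset.count_pos, count_content, card_pos]
  simp [Finset.Nonempty]

lemma content_comp_equiv {n : ℕ} (c f : Fin n → ℕ) (e : Equiv.Perm (Fin n)) (b : ℕ) :
    content (fun k => c (e k)) (fun k => f (e k)) b = content c f b :=
  Equiv.sum_comp e fun k => if c k = b then {f k} else (0 : Multiset ℕ)

/-- The number of inversions of a word. -/
def inversions {n : ℕ} (c : Fin n → ℕ) : ℕ :=
  (univ.filter fun p : Fin n × Fin n => p.1 < p.2 ∧ c p.2 < c p.1).card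

lemma inversions_succ {n : ℕ} (c : Fin (n + 1) → ℕ) :
    inversions c = (univ.filter fun k : Fin n => c k.succ < c 0).card +
      inversions fun k => c k.succ := by
  simp only [inversions, card_filter, Fintype.sum_prod_type, Fin.sum_univ_succ]
  simp

/-- Refine the two-valued colouring `m` by a choice of half for every position. -/
def refineColour {n : ℕ} (m : Fin n → ℕ) (g : Fin n → Bool) (k : Fin n) : ℕ :=
  2 * m k + (g k).toNat

lemma cons_eq_iff_eq_erase {x : ℕ} {A B : Multiset ℕ} :
    x ::ₘ A = B ↔ x ∈ B ∧ A = B.erase x := by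
  constructor
  · rintro rfl; simp
  · rintro ⟨h, rfl⟩; exact Multiset.cons_erase h

/-- `q`-count of the refinements of `m` for which the four colours carry prescribed contents. -/
def colourSum {n : ℕ} (q : F) (m f : Fin n → ℕ) (C0 C1 C2 C3 : Multiset ℕ) : F :=
  ∑ g : Fin n → Bool,
    if content (refineColour m g) f 0 = C0 ∧ content (refineColour m g) f 1 = C1 ∧
      content (refineColour m g) f 2 = C2 ∧ content (refineColour m g) f 3 = C3
    then q ^ inversions (refineColour m g) else 0

lemma colourSum_succ {n : ℕ} (q : F) (m f : Fin (n + 1) → ℕ) (C0 C1 C2 C3 : Multiset ℕ) :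
    colourSum q m f C0 C1 C2 C3 = ∑ s : Bool, ∑ g : Fin n → Bool,
      if (if 2 * m 0 + s.toNat = 0 then {f 0} else 0) +
            content (refineColour (fun k => m k.succ) g) (fun k => f k.succ) 0 = C0 ∧
         (if 2 * m 0 + s.toNat = 1 then {f 0} else 0) +
            content (refineColour (fun k => m k.succ) g) (fun k => f k.succ) 1 = C1 ∧
         (if 2 * m 0 + s.toNat = 2 then {f 0} else 0) +
            content (refineColour (fun k => m k.succ) g) (fun k => f k.succ) 2 = C2 ∧
         (if 2 * m 0 + s.toNat = 3 then {f 0} else 0) +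
            content (refineColour (fun k => m k.succ) g) (fun k => f k.succ) 3 = C3
      then q ^ ((univ.filter fun k =>
          refineColour (fun k => m k.succ) g k < 2 * m 0 + s.toNat).card +
        inversions (refineColour (fun k => m k.succ) g)) else 0 := by
  unfold colourSum
  rw [← Fintype.sum_prod_type', ← (Fin.consEquiv fun _ => Bool).sum_comp]
  refine sum_congr rfl fun ⟨s, g⟩ _ => ?_
  have e : (fun k : Fin n => refineColour m (Fin.consEquiv (fun _ => Bool) (s, g)) k.succ) =
      refineColour (fun k => m k.succ) g := by
    funext k; simp [refineColour, Fin.consEquiv]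
  have e0 : refineColour m (Fin.consEquiv (fun _ => Bool) (s, g)) 0 = 2 * m 0 + s.toNat := by
    simp [refineColour, Fin.consEquiv]
  simp only [content_succ, inversions_succ, e, e0]
  congr 3

lemma colourSum_eq {n : ℕ} (q : F) (m f : Fin n → ℕ) (C0 C1 C2 C3 : Multiset ℕ)
    (hm : ∀ k, m k < 2) (hmono : Monotone m) (hf : ∀ i j, i ≤ j → m i = m j → f i ≤ f j)
    (hC : content m f 0 = C0 + C1) (hC' : content m f 1 = C2 + C3) :
    colourSum q m f C0 C1 C2 C3 = mergeCoeff q C0 C1 * mergeCoeff q C2 C3 := by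
  induction n generalizing C0 C1 C2 C3 with
  | zero =>
    have e : ∀ A B : Multiset ℕ, 0 = A + B → A = 0 ∧ B = 0 := by
      intro A B h
      exact add_eq_zero.1 h.symm
    obtain ⟨rfl, rfl⟩ := e _ _ hC
    obtain ⟨rfl, rfl⟩ := e _ _ hC'
    simp [colourSum, content, inversions, mergeCoeff_zero]
  | succ n ih =>
    have ih' := fun C0 C1 C2 C3 => ih (fun k => m k.succ) (fun k => f k.succ) C0 C1 C2 C3
      (fun k => hm _) (fun i j hij => hmono (Fin.succ_le_succ_iff.2 hij))
      (fun i j hij h => hf _ _ (Fin.succ_le_succ_iff.2 hij) h)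
    rw [colourSum_succ, Fintype.sum_bool]
    have hmin : ∀ b, m 0 = b → ∀ y ∈ content m f b, f 0 ≤ y := by
      intro b hb y hy
      obtain ⟨k, hk, rfl⟩ := mem_content.1 hy
      exact hf 0 k (Fin.zero_le k) (hb.trans hk.symm)
    have hmem : f 0 ∈ content m f (m 0) := mem_content.2 ⟨0, rfl, rfl⟩
    have herase : ∀ A B R : Multiset ℕ, {f 0} + R = A + B →
        (f 0 ∈ A → R = A.erase (f 0) + B) ∧ (f 0 ∈ B → R = A + B.erase (f 0)) := by
      intro A B R h
      rw [Multiset.singleton_add] at h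
      refine ⟨fun hA => ?_, fun hB => ?_⟩
      · have := (cons_eq_iff_eq_erase.1 h).2
        rwa [Multiset.erase_add_left_pos _ hA] at this
      · have := (cons_eq_iff_eq_erase.1 h).2
        rwa [Multiset.erase_add_right_pos _ hB] at this
    have hm0 := hm 0
    rw [content_succ] at hC hC'
    interval_cases h0 : m 0
    · have hmin' := hmin 0 rfl
      rw [content_succ, h0, hC] at hmin'
      rw [content_succ, h0, hC] at hmem
      rw [mergeCoeff_rec q hmem hmin', add_mul, add_comm]
      simp only [if_true, zero_ne_one, if_false, zero_add] at hC hC'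
      obtain ⟨hl, hr⟩ := herase _ _ _ hC
      congr 1
      · simp [cons_eq_iff_eq_erase]
        by_cases hA : f 0 ∈ C0
        · rw [if_pos hA, ← ih' _ _ _ _ (hl hA) hC']
          simp [colourSum, hA]
        · simp [hA]
      · simp [cons_eq_iff_eq_erase]
        by_cases hB : f 0 ∈ C1
        · rw [if_pos hB, mul_assoc, ← ih' _ _ _ _ (hr hB) hC', colourSum, mul_sum]
          refine sum_congr rfl fun g _ => ?_
          simp only [hB, true_and, mul_ite, mul_zero]
          refine if_ctx_congr Iff.rfl (fun hcond => ?_) fun _ => rfl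
          · rw [← hcond.1, card_content, pow_add]
        · simp [hB]
    · have hmin' := hmin 1 rfl
      rw [content_succ, h0, hC'] at hmin'
      rw [content_succ, h0, hC'] at hmem
      have hm1 : ∀ k : Fin n, m k.succ = 1 := fun k => by
        have := hmono (Fin.zero_le k.succ)
        have := hm k.succ
        omega
      have hz : C0 + C1 = 0 := by
        rw [← hC]
        simp [content, hm1]
      obtain ⟨rfl, rfl⟩ := add_eq_zero.1 hz
      rw [mergeCoeff_rec q hmem hmin', mul_add, add_comm]
      simp only [if_true, one_ne_zero, if_false, zero_add] at hC hC'
      obtain ⟨hl, hr⟩ := herase _ _ _ hC'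
      congr 1
      · simp [cons_eq_iff_eq_erase]
        by_cases hA : f 0 ∈ C2
        · rw [if_pos hA, ← ih' _ _ _ _ hC (hl hA)]
          have hempty : ∀ x : Fin n → Bool, (univ.filter fun k => 2 + (x k).toNat ≤ 1) = ∅ :=
            fun x => filter_eq_empty_iff.2 fun k _ => by omega
          simp [colourSum, hA, refineColour, hm1, hempty]
        · simp [hA]
      · simp [cons_eq_iff_eq_erase]
        by_cases hB : f 0 ∈ C3
        · rw [if_pos hB, mul_left_comm, ← ih' _ _ _ _ hC (hr hB), colourSum, mul_sum]
          refine sum_congr rfl fun g _ => ?_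
          simp only [hB, true_and, mul_ite, mul_zero]
          refine if_ctx_congr Iff.rfl (fun hcond => ?_) fun _ => rfl
          · rw [← hcond.2.2.1, card_content, pow_add]
            congr 3
            refine filter_congr fun k _ => ?_
            simp only [refineColour, hm1]
            omega
        · simp [hB]

end
end FayersSemistd

namespace FayersSemistd

section
open Finset

/-! ### Permutations that increase on the blocks of a colouring -/

lemma perm_inv_apply_self {α : Type*} (w : Equiv.Perm α) (p : α) : w⁻¹ (w p) = p :=
  w.symm_apply_apply p

lemma perm_apply_inv_self {α : Type*} (w : Equiv.Perm α) (p : α) : w (w⁻¹ p) = p :=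
  w.apply_symm_apply p

/-- `d` is increasing on each colour class of `c`. -/
def BlockIncr {n : ℕ} (c : Fin n → ℕ) (d : Equiv.Perm (Fin n)) : Prop :=
  ∀ p p', c p = c p' → p < p' → d p < d p'

lemma exists_blockIncr_mul {n : ℕ} {c : Fin n → ℕ} (hc : Monotone c) (w : Equiv.Perm (Fin n)) :
    ∃ u : Equiv.Perm (Fin n), (∀ p, c (u p) = c p) ∧ BlockIncr c (w * u) := by
  set σ := Tuple.sort fun p => toLex (c p, w p) with hσ
  have hmono : ∀ p p', p ≤ p' → toLex (c (σ p), w (σ p)) ≤ toLex (c (σ p'), w (σ p')) :=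
    fun p p' h => Tuple.monotone_sort (fun p => toLex (c p, w p)) h
  have hcσ : c ∘ σ = c ∘ (1 : Equiv.Perm (Fin n)) := by
    apply Tuple.unique_monotone _ (by simpa using hc)
    intro p p' h
    rcases Prod.Lex.toLex_le_toLex.1 (hmono p p' h) with h | h
    · exact h.le
    · exact h.1.le
  refine ⟨σ, congrFun hcσ, fun p p' hp hlt => ?_⟩
  have e : c (σ p) = c (σ p') := by
    rw [show c (σ p) = c p from congrFun hcσ p, hp]
    exact (congrFun hcσ p').symm
  rcases Prod.Lex.toLex_le_toLex.1 (hmono p p' hlt.le) with h | h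
  · exact absurd e h.ne
  · exact h.2.lt_of_ne fun h' => hlt.ne (σ.injective (w.injective h'))

lemma eq_one_of_blockIncr {n : ℕ} {c : Fin n → ℕ} (hc : Monotone c) {d u : Equiv.Perm (Fin n)}
    (hd : BlockIncr c d) (hdu : BlockIncr c (d * u)) (hu : ∀ p, c (u p) = c p) : u = 1 := by
  apply eq_one_of_strictMono
  intro p p' hlt
  rcases (hc hlt.le).lt_or_eq with h | h
  · rw [← hu p, ← hu p'] at h
    exact lt_of_not_ge fun hge => h.not_ge (hc hge)
  · rcases lt_trichotomy (u p) (u p') with h' | h' | h'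
    · exact h'
    · exact absurd (u.injective h') hlt.ne
    · exact absurd (hd _ _ (by rw [hu, hu, h]) h') (hdu _ _ h hlt).not_gt

/-- The length of a block-increasing permutation is the number of inversions of the
corresponding word. -/
lemma permLength_eq_inversions {n : ℕ} {c : Fin n → ℕ} (hc : Monotone c) {d : Equiv.Perm (Fin n)}
    (hd : BlockIncr c d) : permLength d = inversions fun k => c (d⁻¹ k) := by
  unfold permLength inversions
  refine card_bij (fun p _ => (d p.2, d p.1)) ?_ ?_ ?_
  · rintro ⟨a, b⟩ h
    simp only [mem_filter, mem_univ, true_and, perm_inv_apply_self] at h ⊢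
    refine ⟨h.2, (hc h.1.le).lt_of_ne fun e => (hd _ _ e h.1).asymm h.2⟩
  · rintro ⟨a, b⟩ _ ⟨a', b'⟩ _ h
    simpa [and_comm] using h
  · rintro ⟨a, b⟩ h
    simp only [mem_filter, mem_univ, true_and] at h
    refine ⟨(d⁻¹ b, d⁻¹ a), ?_, by simp⟩
    simp only [mem_filter, mem_univ, true_and, perm_apply_inv_self]
    exact ⟨lt_of_not_ge fun hge => h.2.not_ge (hc hge), h.1⟩

/-- Two functions on a finite type with fibres of equal sizes differ by a permutation. -/
lemma exists_perm_of_card_fiber_eq {α β : Type*} [Fintype α] (f g : α → β)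
    (h : ∀ y, (univ.filter fun k => f k = y).card = (univ.filter fun k => g k = y).card) :
    ∃ e : Equiv.Perm α, ∀ k, g (e k) = f k := by
  have e : ∀ y, {k // f k = y} ≃ {k // g k = y} := fun y =>
    Fintype.equivOfCardEq (by rw [Fintype.card_subtype, Fintype.card_subtype, h])
  exact ⟨Equiv.ofFiberEquiv e, Equiv.ofFiberEquiv_map e⟩

/-- Words having equal contents on the colour classes of `c` differ by a permutation
preserving `c`. -/
lemma exists_perm_of_content_eq {n : ℕ} {c f g : Fin n → ℕ}
    (h : ∀ b, content c f b = content c g b) :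
    ∃ e : Equiv.Perm (Fin n), (∀ k, c (e k) = c k) ∧ ∀ k, g (e k) = f k := by
  obtain ⟨e, he⟩ := exists_perm_of_card_fiber_eq (fun k => (c k, f k)) (fun k => (c k, g k))
    fun ⟨b, x⟩ => by
      simp only [Prod.mk.injEq]
      rw [← count_content, ← count_content, h]
  exact ⟨e, fun k => congrArg Prod.fst (he k), fun k => congrArg Prod.snd (he k)⟩

/-! ### Rows of a composition -/

lemma cumSum_succ (lam : ℕ → ℕ) (b : ℕ) : cumSum lam (b + 1) = cumSum lam b + lam b :=
  sum_range_succ _ _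

lemma cumSum_mono (lam : ℕ → ℕ) : Monotone (cumSum lam) :=
  monotone_nat_of_le_succ fun b => by rw [cumSum_succ]; omega

lemma IsComposition.cumSum_le {n : ℕ} {lam : ℕ → ℕ} (h : IsComposition n lam) (b : ℕ) :
    cumSum lam b ≤ n := by
  obtain ⟨N, hN, rfl⟩ := h
  rcases le_total b N with hb | hb
  · exact cumSum_mono lam hb
  · induction b, hb using Nat.le_induction with
    | base => rfl
    | succ b hb ih => rw [cumSum_succ, hN b hb]; exact ih

lemma IsComposition.rowOf_eq_iff {n : ℕ} {lam : ℕ → ℕ} (h : IsComposition n lam) {k b : ℕ}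
    (hk : k < n) : rowOf lam k = b ↔ cumSum lam b ≤ k ∧ k < cumSum lam (b + 1) := by
  have hne : {r | k < cumSum lam (r + 1)}.Nonempty := by
    obtain ⟨N, -, rfl⟩ := h
    exact ⟨N, hk.trans_le (cumSum_mono lam (Nat.le_succ N))⟩
  have hmem : k < cumSum lam (rowOf lam k + 1) := Nat.sInf_mem hne
  have hle : cumSum lam (rowOf lam k) ≤ k := by
    rcases hr : rowOf lam k with _ | r
    · simp [cumSum]
    · by_contra! hlt
      have : rowOf lam k ≤ r := Nat.sInf_le hlt
      omega
  constructor
  · rintro rfl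
    exact ⟨hle, hmem⟩
  · rintro ⟨h1, h2⟩
    apply le_antisymm
    · exact Nat.sInf_le h2
    · by_contra! hlt
      have := cumSum_mono lam (Nat.succ_le_of_lt hlt)
      simp only [Nat.succ_eq_add_one] at this
      omega

lemma IsComposition.rowOf_mono {n : ℕ} {lam : ℕ → ℕ} (h : IsComposition n lam) :
    Monotone fun k : Fin n => rowOf lam k := by
  intro k k' hk
  by_contra! hlt
  have h1 := (h.rowOf_eq_iff k.2).1 rfl
  have h2 := (h.rowOf_eq_iff k'.2).1 rfl
  have := cumSum_mono lam (Nat.succ_le_of_lt hlt)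
  simp only [Nat.succ_eq_add_one] at this
  have := Fin.le_def.1 hk
  omega

/-- A sum over a row of the diagram is a sum over its columns. -/
lemma IsComposition.sum_row {n : ℕ} {lam : ℕ → ℕ} (h : IsComposition n lam) (b : ℕ)
    {M : Type*} [AddCommMonoid M] (g : ℕ → M) :
    (∑ k : Fin n, if rowOf lam k = b then g (k - cumSum lam b) else 0) =
      ∑ j ∈ range (lam b), g j := by
  have hle := h.cumSum_le (b + 1)
  rw [cumSum_succ] at hle
  rw [← sum_filter]
  refine sum_bij' (fun k _ => (k : ℕ) - cumSum lam b)
    (fun j hj => ⟨cumSum lam b + j, by rw [mem_range] at hj; omega⟩) ?_ ?_ ?_ ?_ ?_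
  · intro k hk
    rw [mem_filter, h.rowOf_eq_iff k.2, cumSum_succ] at hk
    rw [mem_range]
    omega
  · intro j hj
    rw [mem_range] at hj
    rw [mem_filter, h.rowOf_eq_iff (by simp only; omega), cumSum_succ]
    simp only [mem_univ, true_and]
    omega
  · intro k hk
    rw [mem_filter, h.rowOf_eq_iff k.2] at hk
    ext
    simp only
    omega
  · intro j _
    simp
  · intro k _
    rfl

lemma IsComposition.card_row {n : ℕ} {lam : ℕ → ℕ} (h : IsComposition n lam) (b : ℕ) :
    (univ.filter fun k : Fin n => rowOf lam k = b).card = lam b := by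
  rw [card_filter, h.sum_row b fun _ => 1]
  simp

lemma isComposition_count (M : Multiset ℕ) {lam : ℕ → ℕ} (h : ∀ x, lam x = M.count x) :
    IsComposition M.card lam := by
  refine ⟨M.sup + 1, fun x hx => ?_, ?_⟩
  · rw [h, Multiset.count_eq_zero]
    intro hm
    have := Multiset.le_sup hm
    omega
  · unfold cumSum
    simp only [h]
    convert Multiset.sum_count_eq_card (s := range (M.sup + 1)) (m := M) fun a ha => ?_
    exact mem_range.2 (Nat.lt_succ_of_le (Multiset.le_sup ha))

/-! ### Double cosets and tableaux -/

lemma mul_mem_youngW {n : ℕ} {lam : ℕ → ℕ} {a b : Equiv.Perm (Fin n)} (ha : a ∈ youngW lam)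
    (hb : b ∈ youngW lam) : a * b ∈ youngW lam := fun p => (ha (b p)).trans (hb p)

lemma inv_mem_youngW {n : ℕ} {lam : ℕ → ℕ} {a : Equiv.Perm (Fin n)} (ha : a ∈ youngW lam) :
    a⁻¹ ∈ youngW lam := fun p => by
  have := ha (a⁻¹ p)
  rwa [perm_apply_inv_self, eq_comm] at this

lemma mem_doubleCoset_iff {n : ℕ} {lam mu : ℕ → ℕ} {d w : Equiv.Perm (Fin n)} :
    w ∈ doubleCoset lam mu d ↔ ∀ b,
      content (fun k : Fin n => rowOf mu k) (fun k => rowOf lam (w⁻¹ k : Fin n)) b =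
        content (fun k : Fin n => rowOf mu k) (fun k => rowOf lam (d⁻¹ k : Fin n)) b := by
  constructor
  · rintro ⟨u, hu, v, hv, rfl⟩ b
    rw [← content_comp_equiv _ (fun k => rowOf lam (d⁻¹ k : Fin n)) v⁻¹ b]
    congr 1
    · funext k
      exact (inv_mem_youngW hv k).symm
    · funext k
      simpa using inv_mem_youngW hu (d⁻¹ (v⁻¹ k))
  · intro h
    obtain ⟨e, he, hf⟩ := exists_perm_of_content_eq h
    refine ⟨d⁻¹ * e * w, fun p => ?_, e⁻¹, inv_mem_youngW he, by group⟩
    simpa using hf (w p)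

lemma sum_range_card_getD (L : List ℕ) :
    ∑ j ∈ range L.length, ({L.getD j 0} : Multiset ℕ) = L := by
  induction L with
  | nil => rfl
  | cons a L ih =>
    rw [List.length_cons, sum_range_succ']
    simp only [List.getD_cons_succ, List.getD_cons_zero, ih]
    rw [← Multiset.cons_coe, ← Multiset.singleton_add, add_comm]

lemma Is1A.content_eq {n : ℕ} {mu lam : ℕ → ℕ} {A : ℕ → Multiset ℕ} {d : Equiv.Perm (Fin n)}
    (h : Is1A mu lam A d) (hmu : IsComposition n mu) (hA : RowsOfShape mu A) (b : ℕ) :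
    content (fun k : Fin n => rowOf mu k) (fun k => rowOf lam (d⁻¹ k : Fin n)) b = A b := by
  have : ∀ k : Fin n, (if rowOf mu k = b then {rowOf lam (d⁻¹ k : Fin n)} else 0 : Multiset ℕ) =
      if rowOf mu k = b then {entryAt A b (k - cumSum mu b)} else 0 := by
    intro k
    split_ifs with hk
    · rw [← h.2 (d⁻¹ k), perm_apply_inv_self, hk]
    · rfl
  unfold content
  rw [sum_congr rfl fun k _ => this k, hmu.sum_row b fun j => {entryAt A b j}, ← hA b]
  unfold entryAt
  conv_rhs => rw [← Multiset.sort_eq (A b) (· ≤ ·)]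
  rw [← sum_range_card_getD, Multiset.length_sort]

lemma Is1A.mem_doubleCoset_iff {n : ℕ} {mu lam : ℕ → ℕ} {A : ℕ → Multiset ℕ}
    {d : Equiv.Perm (Fin n)} (h : Is1A mu lam A d) (hmu : IsComposition n mu)
    (hA : RowsOfShape mu A) (w : Equiv.Perm (Fin n)) :
    w ∈ doubleCoset lam mu d ↔ ∀ b,
      content (fun k : Fin n => rowOf mu k) (fun k => rowOf lam (w⁻¹ k : Fin n)) b = A b := by
  simp only [FayersSemistd.mem_doubleCoset_iff, h.content_eq hmu hA]

end
end FayersSemistd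

namespace FayersSemistd

section
open Finset

variable {F : Type*} [Field F] {H : Type*} [Ring H] [Algebra F H] {n : ℕ} {q : F}
  {T : Equiv.Perm (Fin n) → H}

/-! ### Young symmetrizers -/

lemma IsComposition.same_row_of_inversion {lam : ℕ → ℕ} (hlam : IsComposition n lam)
    {v : Equiv.Perm (Fin n)} (hv : v ∈ youngW lam) {i j : Fin n} (hij : i < j) (hji : v j < v i) :
    rowOf lam i = rowOf lam j := by
  have h1 := hlam.rowOf_mono hij.le
  have h2 := hlam.rowOf_mono hji.le
  simp only [hv i, hv j] at h1 h2
  exact h1.antisymm h2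

/-- Factorization of a Young symmetrizer through a Young subgroup `W_ν ⊆ W_μ`. -/
lemma IsHeckeBasis.xElt_eq_mul (hT : IsHeckeBasis q T) {mu nu : ℕ → ℕ}
    (hnu : IsComposition n nu) (hsub : youngW (n := n) nu ⊆ youngW mu) :
    xElt T mu = xElt T nu * ∑ d ∈ univ.filter fun d =>
      d ∈ youngW mu ∧ BlockIncr (fun k : Fin n => rowOf nu k) d, T d := by
  unfold xElt
  rw [sum_mul_sum, ← sum_product']
  symm
  refine sum_bij (fun p _ => p.2 * p.1) ?_ ?_ ?_ ?_
  · rintro ⟨u, d⟩ h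
    simp only [mem_product, mem_filter, mem_univ, true_and] at h ⊢
    exact mul_mem_youngW h.2.1 (hsub h.1)
  · rintro ⟨u, d⟩ h ⟨u', d'⟩ h' e
    simp only [mem_product, mem_filter, mem_univ, true_and] at h h' e
    have he : d * (u * u'⁻¹) = d' := by rw [← mul_assoc, e, mul_inv_cancel_right]
    have := eq_one_of_blockIncr hnu.rowOf_mono h.2.2 (u := u * u'⁻¹) (by rw [he]; exact h'.2.2)
      (mul_mem_youngW h.1 (inv_mem_youngW h'.1))
    rw [this, mul_one] at he
    rw [mul_inv_eq_one] at this
    rw [this, he]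
  · intro w hw
    simp only [mem_filter, mem_univ, true_and] at hw
    obtain ⟨u, hu, hi⟩ := exists_blockIncr_mul hnu.rowOf_mono w
    refine ⟨(u⁻¹, w * u), ?_, by simp⟩
    simp only [mem_product, mem_filter, mem_univ, true_and]
    exact ⟨inv_mem_youngW hu, mul_mem_youngW hw (hsub hu), hi⟩
  · rintro ⟨u, d⟩ h
    simp only [mem_product, mem_filter, mem_univ, true_and] at h ⊢
    refine hT.mul_eq d u fun a b hab hba => ?_
    have hrow : rowOf nu a < rowOf nu b := (hnu.rowOf_mono hab.le).lt_of_ne fun e =>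
      (h.2.2 a b e hab).asymm hba
    rw [← inv_mem_youngW h.1 a, ← inv_mem_youngW h.1 b] at hrow
    exact lt_of_not_ge fun hge => hrow.not_ge (hnu.rowOf_mono hge)

/-- Every `T_v` with `v ∈ W_λ` acts on `x_λ` by the scalar `q ^ l(v)`. -/
lemma IsHeckeBasis.xElt_mul (hT : IsHeckeBasis q T) {lam : ℕ → ℕ} (hlam : IsComposition n lam)
    (v : Equiv.Perm (Fin n)) (hv : v ∈ youngW lam) :
    xElt T lam * T v = q ^ permLength v • xElt T lam := by
  induction v using perm_ascent_induction with
  | one => simp [hT.one, permLength_one]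
  | step d i h hd ih =>
    set a := d⁻¹ ⟨i, by omega⟩ with ha
    set b := d⁻¹ ⟨i + 1, h⟩ with hb
    have hrow : rowOf lam i = rowOf lam (i + 1) := by
      have h1 := hlam.same_row_of_inversion hv hd
        (by simp [ha, hb, adjT_left, adjT_right])
      have h2 := hv a
      have h3 := hv b
      simp only [ha, hb, Equiv.Perm.mul_apply, perm_apply_inv_self, adjT_left, adjT_right] at h2 h3
      rw [h2, h3, h1]
    have hs : adjT i h ∈ youngW lam := by
      intro p
      unfold adjT
      rw [Equiv.swap_apply_def]
      split_ifs with h1 h2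
      · simp [h1, hrow]
      · simp [h2, hrow]
      · rfl
    have hd' : d ∈ youngW lam := by
      rw [← adjT_mul_adjT_mul h d]
      exact mul_mem_youngW hs hv
    have hx : xElt T lam * T (adjT i h) = q • xElt T lam := by
      apply hT.basis.repr.injective
      ext w
      have key : adjT i h * w ∈ youngW lam ↔ w ∈ youngW lam :=
        ⟨fun h' => by rw [← adjT_mul_adjT_mul h w]; exact mul_mem_youngW hs h',
          fun h' => mul_mem_youngW hs h'⟩
      rw [map_smul, Finsupp.smul_apply]
      rcases ascent_or_descent h w with hw | hw
      · rw [hT.repr_mul_adjT h hw]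
        simp only [xElt, hT.repr_sum, mem_filter, mem_univ, true_and, key, smul_eq_mul]
      · rw [hT.repr_mul_adjT' h hw]
        simp only [xElt, hT.repr_sum, mem_filter, mem_univ, true_and, key, smul_eq_mul]
        ring
    rw [← hT.mul_ascent h hd, ← mul_assoc, ih hd', smul_mul_assoc, hx, smul_smul,
      permLength_adjT_mul h hd, pow_succ]

/-- An element on which `W_μ` acts by `T_v ↦ q ^ l(v)` is determined by its coefficients at the
minimal length coset representatives. -/
lemma IsHeckeBasis.repr_mul_left_eq (hT : IsHeckeBasis q T) (hq : q ≠ 0) {mu : ℕ → ℕ}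
    (hmu : IsComposition n mu) {z : H}
    (hz : ∀ v ∈ youngW mu, z * T v = q ^ permLength v • z) {u w : Equiv.Perm (Fin n)}
    (hu : u ∈ youngW mu) (hw : BlockIncr (fun k : Fin n => rowOf mu k) w⁻¹) :
    hT.basis.repr z (u * w) = hT.basis.repr z w := by
  have hu' := inv_mem_youngW hu
  have h := hT.repr_mul u⁻¹ w z fun i j hij hji => hw i j
    (hmu.same_row_of_inversion (by simpa using hu) hij hji) hij
  rw [hz _ hu', map_smul, Finsupp.smul_apply, smul_eq_mul, inv_inv] at h
  exact (mul_left_cancel₀ (pow_ne_zero _ hq) h).symm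

lemma mul_mem_doubleCoset_iff {lam mu : ℕ → ℕ} {d u w : Equiv.Perm (Fin n)}
    (hu : u ∈ youngW mu) : u * w ∈ doubleCoset lam mu d ↔ w ∈ doubleCoset lam mu d := by
  constructor
  · rintro ⟨a, ha, b, hb, e⟩
    refine ⟨a, ha, u⁻¹ * b, mul_mem_youngW (inv_mem_youngW hu) hb, ?_⟩
    rw [mul_assoc, mul_assoc, ← mul_assoc b, ← e, inv_mul_cancel_left]
  · rintro ⟨a, ha, b, hb, rfl⟩
    exact ⟨a, ha, u * b, mul_mem_youngW hu hb, by simp only [mul_assoc]⟩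

/-! ### Refinements of a colouring and coset representatives -/

lemma content_eq_add_refineColour (m f : Fin n → ℕ) (g : Fin n → Bool) (b : ℕ) :
    content m f b =
      content (refineColour m g) f (2 * b) + content (refineColour m g) f (2 * b + 1) := by
  unfold content
  rw [← sum_add_distrib]
  refine sum_congr rfl fun k _ => ?_
  unfold refineColour
  cases g k <;> simp only [Bool.toNat_false, Bool.toNat_true] <;>
    split_ifs <;> first | omega | simp

lemma content_eq_zero {c f : Fin n → ℕ} {b : ℕ} (h : ∀ k, c k ≠ b) : content c f b = 0 :=
  sum_eq_zero fun k _ => if_neg (h k)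

lemma forall_content_eq_rows2 {c f : Fin n → ℕ} (hc : ∀ k, c k < 2) (A B : Multiset ℕ) :
    (∀ b, content c f b = rows2 A B b) ↔ content c f 0 = A ∧ content c f 1 = B := by
  refine ⟨fun h => ⟨h 0, h 1⟩, fun h b => ?_⟩
  rcases b with _ | _ | b
  · exact h.1
  · exact h.2
  · exact content_eq_zero fun k => by have := hc k; omega

lemma forall_content_eq_rows4 {c f : Fin n → ℕ} (hc : ∀ k, c k < 4) (C0 C1 C2 C3 : Multiset ℕ) :
    (∀ b, content c f b = rows4 C0 C1 C2 C3 b) ↔ content c f 0 = C0 ∧ content c f 1 = C1 ∧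
      content c f 2 = C2 ∧ content c f 3 = C3 := by
  refine ⟨fun h => ⟨h 0, h 1, h 2, h 3⟩, fun h b => ?_⟩
  rcases b with _ | _ | _ | _ | b
  · exact h.1
  · exact h.2.1
  · exact h.2.2.1
  · exact h.2.2.2
  · exact content_eq_zero fun k => by have := hc k; omega

/-- The coset representatives of `W_ν` in `W_μ` correspond to refinements of the colouring by
rows of `μ`. -/
lemma sum_cosetReps_eq_colourSum {mu nu : ℕ → ℕ} (hnu : IsComposition n nu)
    (hhalf : ∀ k : Fin n, rowOf mu k = rowOf nu k / 2) (hlt : ∀ k : Fin n, rowOf nu k < 4)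
    (f : Fin n → ℕ) {C0 C1 C2 C3 : Multiset ℕ} (hC : RowsOfShape nu (rows4 C0 C1 C2 C3)) (q : F) :
    (∑ d ∈ univ.filter fun d : Equiv.Perm (Fin n) =>
        d ∈ youngW mu ∧ BlockIncr (fun k : Fin n => rowOf nu k) d,
      if ∀ b, content (fun k => rowOf nu (d⁻¹ k : Fin n)) f b = rows4 C0 C1 C2 C3 b
      then q ^ permLength d else 0) =
    colourSum q (fun k : Fin n => rowOf mu k) f C0 C1 C2 C3 := by
  unfold colourSum
  rw [← sum_filter, ← sum_filter, filter_filter]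
  have href : ∀ d ∈ youngW (n := n) mu,
      refineColour (fun k : Fin n => rowOf mu k)
        (fun k => decide (rowOf nu (d⁻¹ k : Fin n) % 2 = 1)) =
      fun k => rowOf nu (d⁻¹ k : Fin n) := by
    intro d hd
    funext k
    unfold refineColour
    have h := inv_mem_youngW hd k
    rw [hhalf] at h
    rcases Nat.mod_two_eq_zero_or_one (rowOf nu (d⁻¹ k : Fin n)) with h0 | h0 <;>
      simp only [h0, ← h, decide_true, Bool.toNat_true, zero_ne_one, decide_false,
        Bool.toNat_false] <;> omega
  refine sum_bij (fun d _ k => decide (rowOf nu (d⁻¹ k : Fin n) % 2 = 1)) ?_ ?_ ?_ ?_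
  · intro d hd
    simp only [mem_filter, mem_univ, true_and] at hd ⊢
    rw [href d hd.1.1]
    exact (forall_content_eq_rows4 (fun k => hlt _) _ _ _ _).1 hd.2
  · intro d hd d' hd' e
    simp only [mem_filter, mem_univ, true_and] at hd hd'
    have e' : (fun k => rowOf nu (d⁻¹ k : Fin n)) = fun k => rowOf nu (d'⁻¹ k : Fin n) := by
      rw [← href d hd.1.1, ← href d' hd'.1.1]
      exact congrArg _ e
    have := eq_one_of_blockIncr hnu.rowOf_mono hd.1.2 (u := d⁻¹ * d')
      (by rw [mul_inv_cancel_left]; exact hd'.1.2) fun p => by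
        have := congrFun e' (d' p)
        simpa only [perm_inv_apply_self, Equiv.Perm.mul_apply] using this
    exact inv_mul_eq_one.1 this
  · intro g hg
    simp only [mem_filter, mem_univ, true_and] at hg
    set c := refineColour (fun k : Fin n => rowOf mu k) g with hc
    have hc4 : ∀ k, c k / 2 = rowOf mu k := fun k => by
      simp only [hc, refineColour]
      have := Bool.toNat_lt (g k)
      omega
    have hg' := (forall_content_eq_rows4 (fun k => by
      have h1 := hc4 k
      have h2 := hlt k
      rw [hhalf] at h1
      omega) _ _ _ _).2 hg
    obtain ⟨e, he⟩ := exists_perm_of_card_fiber_eq (fun k : Fin n => rowOf nu k) c fun b => by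
      have h := card_content c f b
      rw [hg', hC] at h
      convert (hnu.card_row b).trans h
    obtain ⟨u, hu, hi⟩ := exists_blockIncr_mul hnu.rowOf_mono e
    have hce : ∀ p, c ((e * u) p) = rowOf nu p := fun p => (he (u p)).trans (hu p)
    have hce' : (fun k => rowOf nu ((e * u)⁻¹ k : Fin n)) = c := by
      funext k
      rw [← hce, perm_apply_inv_self]
    have hmem : e * u ∈ youngW mu := fun p => by rw [← hc4, hce, hhalf]
    refine ⟨e * u, ?_, ?_⟩
    · simp only [mem_filter, mem_univ, true_and]
      refine ⟨⟨hmem, hi⟩, ?_⟩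
      rw [hce']
      exact hg'
    · funext k
      have := congrFun ((href _ hmem).trans hce') k
      simp only [hc, refineColour] at this
      have hinj : ∀ x y : Bool, x.toNat = y.toNat → x = y := by decide
      exact hinj _ _ (by omega)
  · intro d hd
    simp only [mem_filter, mem_univ, true_and] at hd
    rw [href d hd.1.1, permLength_eq_inversions hnu.rowOf_mono hd.1.2]

/-- The value of `colourSum` without assumption on the contents of the colour classes. -/
lemma colourSum_eq_ite (q : F) (m f : Fin n → ℕ) (C0 C1 C2 C3 : Multiset ℕ)
    (hm : ∀ k, m k < 2) (hmono : Monotone m) (hf : ∀ i j, i ≤ j → m i = m j → f i ≤ f j) :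
    colourSum q m f C0 C1 C2 C3 =
      if content m f 0 = C0 + C1 ∧ content m f 1 = C2 + C3
      then mergeCoeff q C0 C1 * mergeCoeff q C2 C3 else 0 := by
  split_ifs with h
  · exact colourSum_eq q m f C0 C1 C2 C3 hm hmono hf h.1 h.2
  · refine sum_eq_zero fun g _ => if_neg fun hg => h ?_
    rw [content_eq_add_refineColour m f g 0, content_eq_add_refineColour m f g 1]
    simp only [mul_zero, zero_add, mul_one, Nat.reduceAdd, hg.1, hg.2.1, hg.2.2.1, hg.2.2.2,
      and_self]

end
end FayersSemistd

namespace FayersSemistd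

section
open Finset

variable {F : Type*} [Field F] {H : Type*} [Ring H] [Algebra F H] {n : ℕ} {q : F}
  {T : Equiv.Perm (Fin n) → H}

lemma isComposition_comp2 {a b : ℕ} (h : a + b = n) : IsComposition n (comp2 a b) := by
  refine ⟨2, fun x hx => ?_, by simp [cumSum, comp2, sum_range_succ, h]⟩
  unfold comp2
  rw [if_neg (by omega), if_neg (by omega)]

lemma isComposition_comp4 {a b c d : ℕ} (h : a + b + c + d = n) :
    IsComposition n (comp4 a b c d) := by
  refine ⟨4, fun x hx => ?_, by simp [cumSum, comp4, sum_range_succ, h]⟩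
  unfold comp4
  rw [if_neg (by omega), if_neg (by omega), if_neg (by omega), if_neg (by omega)]

lemma rowOf_comp4_lt {a b c d : ℕ} (h : a + b + c + d = n) (k : Fin n) :
    rowOf (comp4 a b c d) k < 4 := by
  by_contra! hge
  have h1 := ((isComposition_comp4 h).rowOf_eq_iff k.2).1 rfl
  have h2 := cumSum_mono (comp4 a b c d) hge
  have h3 : cumSum (comp4 a b c d) 4 = n := by simp [cumSum, comp4, sum_range_succ, h]
  omega

/-- Merging the rows of `(a, b, c, d)` in pairs halves the row index. -/
lemma rowOf_comp2_eq {a b c d : ℕ} (h : a + b + c + d = n) (k : Fin n) :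
    rowOf (comp2 (a + b) (c + d)) k = rowOf (comp4 a b c d) k / 2 := by
  rw [(isComposition_comp2 (by omega)).rowOf_eq_iff k.2]
  have h1 := ((isComposition_comp4 h).rowOf_eq_iff k.2).1 rfl
  have h2 := rowOf_comp4_lt h k
  interval_cases rowOf (comp4 a b c d) k <;>
    simp [cumSum, comp2, comp4, sum_range_succ] at h1 ⊢ <;> omega

lemma youngW_comp4_subset {a b c d : ℕ} (h : a + b + c + d = n) :
    youngW (n := n) (comp4 a b c d) ⊆ youngW (comp2 (a + b) (c + d)) := fun w hw p => by
  rw [rowOf_comp2_eq h, rowOf_comp2_eq h, hw p]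

/-- The double coset of the tableau merging pairs of rows is the Young subgroup itself. -/
lemma XPhi_merge {a b c d : ℕ} (h : a + b + c + d = n) {dB : Equiv.Perm (Fin n)}
    (hdB : Is1A (comp2 (a + b) (c + d)) (comp4 a b c d)
      (rows2 (Multiset.replicate a 0 + Multiset.replicate b 1)
             (Multiset.replicate c 2 + Multiset.replicate d 3)) dB)
    (T : Equiv.Perm (Fin n) → H) :
    XPhi T (comp4 a b c d) (comp2 (a + b) (c + d)) dB = xElt T (comp2 (a + b) (c + d)) := by
  have hmu : IsComposition n (comp2 (a + b) (c + d)) := isComposition_comp2 (by omega)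
  have hcontent := hdB.content_eq hmu fun r => by
    rcases r with _ | _ | r <;> simp [rows2, comp2]
  have hmem : dB⁻¹ ∈ youngW (comp2 (a + b) (c + d)) := fun k => by
    have hk := (mem_content (c := fun k : Fin n => rowOf (comp2 (a + b) (c + d)) k)
      (f := fun k => rowOf (comp4 a b c d) (dB⁻¹ k : Fin n))).2 ⟨k, rfl, rfl⟩
    rw [hcontent] at hk
    rw [rowOf_comp2_eq h (dB⁻¹ k)]
    have hlt : rowOf (comp2 (a + b) (c + d)) k < 2 := by
      have := rowOf_comp4_lt h k
      rw [rowOf_comp2_eq h]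
      omega
    interval_cases rowOf (comp2 (a + b) (c + d)) k <;>
      simp only [rows2, one_ne_zero, if_true, if_false, Multiset.mem_add,
        Multiset.mem_replicate] at hk <;> omega
  have hB : dB ∈ youngW (comp2 (a + b) (c + d)) := by simpa using inv_mem_youngW hmem
  unfold XPhi xElt
  congr 1
  ext w
  simp only [mem_filter, mem_univ, true_and]
  constructor
  · rintro ⟨u, hu, v, hv, rfl⟩
    exact mul_mem_youngW (mul_mem_youngW hv hB) (youngW_comp4_subset h hu)
  · intro hw
    exact ⟨1, fun p => rfl, w * dB⁻¹, mul_mem_youngW hw hmem, by simp⟩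

lemma op_algebraMap_smul (c : F) (x : H) : MulOpposite.op (algebraMap F H c) • x = c • x := by
  rw [op_smul_eq_mul, ← Algebra.commutes, Algebra.smul_def]

/-- The coefficients of `X_C ∑ T_d`, the sum running over the coset representatives of `W_ν`
in `W_μ`, at minimal length representatives. -/
lemma IsHeckeBasis.repr_XPhi_mul_sum (hT : IsHeckeBasis q T) {mu nu lam : ℕ → ℕ}
    (hmu : IsComposition n mu) (hnu : IsComposition n nu) (hlam : IsComposition n lam)
    (hhalf : ∀ k : Fin n, rowOf mu k = rowOf nu k / 2) (hlt : ∀ k : Fin n, rowOf nu k < 4)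
    {C0 C1 C2 C3 : Multiset ℕ} (hC : RowsOfShape nu (rows4 C0 C1 C2 C3))
    {dC : Equiv.Perm (Fin n)} (hdC : Is1A nu lam (rows4 C0 C1 C2 C3) dC)
    {w : Equiv.Perm (Fin n)} (hw : BlockIncr (fun k : Fin n => rowOf mu k) w⁻¹) :
    hT.basis.repr (XPhi T lam nu dC * ∑ d ∈ univ.filter fun d =>
      d ∈ youngW mu ∧ BlockIncr (fun k : Fin n => rowOf nu k) d, T d) w =
    if ∀ b, content (fun k : Fin n => rowOf mu k) (fun k => rowOf lam (w⁻¹ k : Fin n)) b =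
        rows2 (C0 + C1) (C2 + C3) b
    then mergeCoeff q C0 C1 * mergeCoeff q C2 C3 else 0 := by
  have hmu2 : ∀ k : Fin n, rowOf mu k < 2 := fun k => by
    have := hlt k
    rw [hhalf]
    omega
  simp only [forall_content_eq_rows2 hmu2]
  rw [← colourSum_eq_ite q _ _ _ _ _ _ hmu2 hmu.rowOf_mono fun i j hij hrow => ?_,
    ← sum_cosetReps_eq_colourSum hnu hhalf hlt _ hC q, mul_sum, map_sum, Finsupp.finsetSum_apply]
  · refine sum_congr rfl fun d hd => ?_
    simp only [mem_filter, mem_univ, true_and] at hd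
    rw [hT.repr_mul d w _ fun i j hij hji => hw i j
      (hmu.same_row_of_inversion (inv_mem_youngW hd.1) hij hji) hij]
    have hiff : d⁻¹ * w ∈ doubleCoset lam nu dC ↔
        ∀ b, content (fun k => rowOf nu (d⁻¹ k : Fin n)) (fun k => rowOf lam (w⁻¹ k : Fin n)) b =
          rows4 C0 C1 C2 C3 b := by
      rw [hdC.mem_doubleCoset_iff hnu hC]
      refine forall_congr' fun b => ?_
      rw [← content_comp_equiv _ _ d⁻¹ b]
      simp only [mul_inv_rev, inv_inv, Equiv.Perm.mul_apply, perm_apply_inv_self]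
    unfold XPhi
    rw [hT.repr_sum]
    simp only [mem_filter, mem_univ, true_and, hiff, mul_ite, mul_one, mul_zero]
  · rcases hij.lt_or_eq with h | h
    · exact hlam.rowOf_mono (hw i j hrow h).le
    · rw [h]

end
end FayersSemistd
namespace FayersSemistd

/-- Proposition: merging rows in pairs.
`(r,u,v,t) ⊨ n`; `C` a row-standard `(r,u,v,t)`-tableau of type `λ` (rows
`C0,C1,C2,C3`); `B` the row-standard `(r+u,v+t)`-tableau with `r` entries `0` and `u`
entries `1` in row one, `v` entries `2` and `t` entries `3` in row two; `A` the
row-standard `(r+u,v+t)`-tableau with rows `C0 ⊔ C1` and `C2 ⊔ C3`.  Then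
`φ_B φ_C = (∏_i [A^1_i, C^1_i][A^2_i, C^3_i]) (∏_{i<j} q^{C^1_j C^2_i + C^3_j C^4_i}) φ_A`
as homomorphisms `M^{(r+u,v+t)} → M^λ` (apply `φ_B` first). -/
theorem merge_rows_in_pairs
    {F : Type*} [Field F] {H : Type*} [Ring H] [Algebra F H]
    {n r u v t : ℕ} (hn : r + u + v + t = n)
    (q : F) (hq : q ≠ 0)
    (T : Equiv.Perm (Fin n) → H) (hT : IsHeckeBasis q T)
    (C0 C1 C2 C3 : Multiset ℕ)
    (hC0 : C0.card = r) (hC1 : C1.card = u) (hC2 : C2.card = v) (hC3 : C3.card = t)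
    (lam : ℕ → ℕ) (hlam : ∀ x, lam x = (C0 + C1 + C2 + C3).count x)
    (dB : Equiv.Perm (Fin n))
    (hdB : Is1A (comp2 (r+u) (v+t)) (comp4 r u v t)
      (rows2 (Multiset.replicate r 0 + Multiset.replicate u 1)
             (Multiset.replicate v 2 + Multiset.replicate t 3)) dB)
    (dC : Equiv.Perm (Fin n))
    (hdC : Is1A (comp4 r u v t) lam (rows4 C0 C1 C2 C3) dC)
    (dA : Equiv.Perm (Fin n))
    (hdA : Is1A (comp2 (r+u) (v+t)) lam (rows2 (C0 + C1) (C2 + C3)) dA)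
    (Mmu : Submodule Hᵐᵒᵖ H)
    (hMmu : Mmu = Submodule.span Hᵐᵒᵖ {xElt T (comp2 (r+u) (v+t))})
    (Mnu : Submodule Hᵐᵒᵖ H)
    (hMnu : Mnu = Submodule.span Hᵐᵒᵖ {xElt T (comp4 r u v t)})
    (hxmu : xElt T (comp2 (r+u) (v+t)) ∈ Mmu) (hxnu : xElt T (comp4 r u v t) ∈ Mnu)
    (φB : Mmu →ₗ[Hᵐᵒᵖ] H)
    (hφB : φB ⟨xElt T (comp2 (r+u) (v+t)), hxmu⟩
      = XPhi T (comp4 r u v t) (comp2 (r+u) (v+t)) dB)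
    (hrange : ∀ z : Mmu, φB z ∈ Mnu)
    (φC : Mnu →ₗ[Hᵐᵒᵖ] H)
    (hφC : φC ⟨xElt T (comp4 r u v t), hxnu⟩ = XPhi T lam (comp4 r u v t) dC)
    (φA : Mmu →ₗ[Hᵐᵒᵖ] H)
    (hφA : φA ⟨xElt T (comp2 (r+u) (v+t)), hxmu⟩ = XPhi T lam (comp2 (r+u) (v+t)) dA) :
    ∀ z : Mmu, φC ⟨φB z, hrange z⟩
      = (qBinomProd q C0 C1 * qBinomProd q C2 C3 *
          q ^ (invPairs C0 C1 + invPairs C2 C3)) • φA z := by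

  intro z
  have hnu := isComposition_comp4 hn
  have hmu : IsComposition n (comp2 (r + u) (v + t)) := isComposition_comp2 (by omega)
  have hlam' : IsComposition n lam := by
    have := isComposition_count (C0 + C1 + C2 + C3) hlam
    rwa [Multiset.card_add, Multiset.card_add, Multiset.card_add, hC0, hC1, hC2, hC3, hn] at this
  have hC : RowsOfShape (comp4 r u v t) (rows4 C0 C1 C2 C3) := fun x => by
    rcases x with _ | _ | _ | _ | x <;> simp [rows4, comp4, *]
  have hA : RowsOfShape (comp2 (r + u) (v + t)) (rows2 (C0 + C1) (C2 + C3)) := fun x => by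
    rcases x with _ | _ | x <;> simp [rows2, comp2, *]
  have hgen : φC ⟨φB ⟨_, hxmu⟩, hrange _⟩ = (qBinomProd q C0 C1 * qBinomProd q C2 C3 *
      q ^ (invPairs C0 C1 + invPairs C2 C3)) • φA ⟨_, hxmu⟩ := by
    have hB : φB ⟨_, hxmu⟩ = xElt T (comp2 (r + u) (v + t)) := hφB.trans (XPhi_merge hn hdB T)
    have hx := hT.xElt_eq_mul hnu (youngW_comp4_subset hn)
    set S := ∑ d ∈ Finset.univ.filter fun d => d ∈ youngW (comp2 (r + u) (v + t)) ∧
      BlockIncr (fun k : Fin n => rowOf (comp4 r u v t) k) d, T d with hS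
    have hz : φC ⟨φB ⟨_, hxmu⟩, hrange _⟩ = XPhi T lam (comp4 r u v t) dC * S := by
      rw [← hφC, ← op_smul_eq_mul, ← map_smul]
      congr 1
      exact Subtype.ext (hB.trans hx)
    have hzT : ∀ w ∈ youngW (comp2 (r + u) (v + t)), φC ⟨φB ⟨_, hxmu⟩, hrange _⟩ * T w =
        q ^ permLength w • φC ⟨φB ⟨_, hxmu⟩, hrange _⟩ := by
      intro w hw
      rw [← op_smul_eq_mul, ← op_algebraMap_smul, ← map_smul, ← map_smul]
      congr 1
      apply Subtype.ext
      change MulOpposite.op (T w) • φB ⟨_, hxmu⟩ =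
        MulOpposite.op (algebraMap F H (q ^ permLength w)) • φB ⟨_, hxmu⟩
      rw [hB, op_smul_eq_mul, op_algebraMap_smul, hT.xElt_mul hmu w hw]
    apply hT.basis.repr.injective
    ext w
    obtain ⟨y, hy, hi⟩ := exists_blockIncr_mul hmu.rowOf_mono w⁻¹
    obtain ⟨w0, hw0⟩ : ∃ w0, w0 = y⁻¹ * w := ⟨_, rfl⟩
    obtain rfl : w = y * w0 := by rw [hw0, mul_inv_cancel_left]
    have hi' : BlockIncr (fun k : Fin n => rowOf (comp2 (r + u) (v + t)) k) w0⁻¹ := by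
      simpa using hi
    rw [hT.repr_mul_left_eq hq hmu hzT hy hi', hz, hS,
      hT.repr_XPhi_mul_sum hmu hnu hlam' (rowOf_comp2_eq hn) (rowOf_comp4_lt hn) hC hdC hi',
      hφA, map_smul, Finsupp.smul_apply, XPhi, hT.repr_sum]
    have hiff := (mul_mem_doubleCoset_iff hy).trans (hdA.mem_doubleCoset_iff hmu hA w0)
    simp only [Finset.mem_filter, Finset.mem_univ, true_and, hiff, smul_eq_mul, mul_ite, mul_one, mul_zero]
    split_ifs
    · unfold mergeCoeff
      ring
    · rfl
  have hz : (z : H) ∈ Submodule.span Hᵐᵒᵖ {xElt T (comp2 (r + u) (v + t))} := by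
    rw [← hMmu]
    exact z.2
  obtain ⟨a, ha⟩ := Submodule.mem_span_singleton.1 hz
  have hza : z = a • ⟨_, hxmu⟩ := Subtype.ext ha.symm
  have hB : (⟨φB z, hrange z⟩ : Mnu) = a • ⟨φB ⟨_, hxmu⟩, hrange _⟩ :=
    Subtype.ext ((congrArg φB hza).trans (map_smul φB a _))
  rw [hB, map_smul, hgen, hza, map_smul]
  induction a using MulOpposite.rec' with
  | h a => rw [op_smul_eq_mul, op_smul_eq_mul, smul_mul_assoc]

end FayersSemistd
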